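/- arXiv:1302.3266 — 3 statements merged into one kernel-verified Lean document; each statement's English description precedes it below -/
import Mathlib

section
/- For every integer a ≥ 0 and every real number ρ > 0 there exists a constant c > 0 (depending only on a and ρ) such that for all real b ≥ 1 one has ∑_{j=a}^∞ (b / j^ρ)^j ≥ c · exp((ρ/e) · b^{1/ρ}). -/
open Real

lemma summable_div_rpow_pow (b ρ : ℝ) (hb : 0 ≤ b) (hρ : 0 < ρ) :
    Summable fun j : ℕ => (b / (j : ℝ) ^ ρ) ^ j := by
  have hlim : Filter.Tendsto (fun j : ℕ => b / (j : ℝ) ^ ρ) Filter.atTop (nhds 0) :=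
    ((tendsto_rpow_atTop hρ).comp tendsto_natCast_atTop_atTop).const_div_atTop b
  refine Summable.of_norm_bounded_eventually_nat (g := fun j : ℕ => (1 / 2 : ℝ) ^ j)
    summable_geometric_two ?_
  filter_upwards [hlim.eventually_le_const (show (0 : ℝ) < 1 / 2 by norm_num)] with j hj
  have h0 : 0 ≤ b / (j : ℝ) ^ ρ := by positivity
  rw [Real.norm_of_nonneg (by positivity)]
  exact pow_le_pow_left₀ h0 hj j

lemma sub_sq_div_le_mul_one_sub_log {y j : ℝ} (hy : 0 < y) (hj : 0 < j) :
    y - (j - y) ^ 2 / y ≤ j * (1 + Real.log y - Real.log j) := by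
  have h := Real.log_le_sub_one_of_pos (div_pos hj hy)
  rw [Real.log_div hj.ne' hy.ne'] at h
  calc y - (j - y) ^ 2 / y = j * (1 - (j / y - 1)) := by field_simp; ring
    _ ≤ j * (1 + Real.log y - Real.log j) := mul_le_mul_of_nonneg_left (by linarith) hj.le

/-- **Lemma 14.1.** For every integer `a ≥ 0` and real `ρ > 0` there is a constant
`c > 0` (depending only on `a` and `ρ`) such that for all `b ≥ 1`,
`∑_{j=a}^∞ (b / j^ρ)^j ≥ c · exp((ρ/e) · b^{1/ρ})`. The `j = 0` term is interpreted as `1`. -/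
theorem sum_pow_ge_exp_rpow (a : ℕ) (ρ : ℝ) (hρ : 0 < ρ) :
    ∃ c : ℝ, 0 < c ∧ ∀ b : ℝ, 1 ≤ b →
      c * Real.exp ((ρ / Real.exp 1) * b ^ (1 / ρ)) ≤
        ∑' j : {j : ℕ // a ≤ j}, (b / ((j : ℕ) : ℝ) ^ ρ) ^ (j : ℕ) := by
  refine ⟨Real.exp (-(ρ * ((a + 1) ^ 2 * Real.exp 1))), Real.exp_pos _, fun b hb => ?_⟩
  have hb0 : 0 < b := by linarith
  -- The summand is largest near `j = y`.
  set y : ℝ := b ^ (1 / ρ) / Real.exp 1 with hy_def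
  have hy : 0 < y := by positivity
  have hy_inv : 1 / y ≤ Real.exp 1 := by
    rw [hy_def, one_div_div]
    exact div_le_self (Real.exp_pos 1).le (Real.one_le_rpow hb (by positivity))
  have hlog : ρ * (1 + Real.log y) = Real.log b := by
    rw [hy_def, Real.log_div (by positivity) (by positivity), Real.log_rpow hb0, Real.log_exp]
    field_simp
    ring
  set j : ℕ := ⌈y⌉₊ + a with hj_def
  have hjy : y ≤ j := by
    rw [hj_def]; push_cast
    linarith [Nat.le_ceil y, Nat.cast_nonneg (α := ℝ) a]
  have hjy' : (j : ℝ) - y ≤ a + 1 := by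
    rw [hj_def]; push_cast
    linarith [Nat.ceil_lt_add_one hy.le]
  have hj : (0 : ℝ) < j := hy.trans_le hjy
  have hsq : ((j : ℝ) - y) ^ 2 / y ≤ (a + 1) ^ 2 * Real.exp 1 := by
    rw [div_eq_mul_one_div]
    have : 0 ≤ (j : ℝ) - y := by linarith
    gcongr
  have hterm : (b / (j : ℝ) ^ ρ) ^ j
      = Real.exp (ρ * (j * (1 + Real.log y - Real.log j))) := by
    rw [← Real.exp_log (show 0 < (b / (j : ℝ) ^ ρ) ^ j by positivity), Real.log_pow,
      Real.log_div hb0.ne' (by positivity), Real.log_rpow hj, ← hlog]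
    ring_nf
  have hsum : Summable fun i : {i : ℕ // a ≤ i} => (b / ((i : ℕ) : ℝ) ^ ρ) ^ (i : ℕ) :=
    (summable_div_rpow_pow b ρ hb0.le hρ).subtype {i | a ≤ i}
  calc Real.exp (-(ρ * ((a + 1) ^ 2 * Real.exp 1))) *
        Real.exp ((ρ / Real.exp 1) * b ^ (1 / ρ))
      = Real.exp (ρ * (y - (a + 1) ^ 2 * Real.exp 1)) := by
        rw [← Real.exp_add, hy_def]; ring_nf
    _ ≤ (b / (j : ℝ) ^ ρ) ^ j := by
        rw [hterm]
        gcongr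
        linarith [sub_sq_div_le_mul_one_sub_log hy hj]
    _ ≤ ∑' i : {i : ℕ // a ≤ i}, (b / ((i : ℕ) : ℝ) ^ ρ) ^ (i : ℕ) :=
        hsum.le_tsum ⟨j, Nat.le_add_left a _⟩ fun i _ => by positivity
end

section
/- Let g : [0,∞) → [0,∞] be measurable. Define h_1(t) := ∫_0^t g(s) ds and, recursively, h_{n+1}(t) := ∫_0^t g(s) h_n(t−s) ds. Then for every integer n ≥ 1 and every t ≥ 0 one has h_n(t) ≥ (∫_0^{t/n} g(s) ds)^n. -/
open MeasureTheory ENNReal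

/-- The inductive lower bound for iterated convolutions in the proof of
Proposition 14.1: if `h_1(t) = ∫_0^t g(s) ds` and
`h_{n+1}(t) = ∫_0^t g(s) h_n(t−s) ds`, then for every `n ≥ 1` and `t ≥ 0`,
`h_n(t) ≥ (∫_0^{t/n} g(s) ds)^n`. -/
theorem iterated_convolution_lower_bound (g : ℝ → ℝ≥0∞) (hg : Measurable g)
    (h : ℕ → ℝ → ℝ≥0∞)
    (h1 : ∀ t : ℝ, 0 ≤ t → h 1 t = ∫⁻ s in Set.Ioc (0 : ℝ) t, g s)
    (hrec : ∀ n : ℕ, 1 ≤ n → ∀ t : ℝ, 0 ≤ t →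
      h (n + 1) t = ∫⁻ s in Set.Ioc (0 : ℝ) t, g s * h n (t - s)) :
    ∀ n : ℕ, 1 ≤ n → ∀ t : ℝ, 0 ≤ t →
      (∫⁻ s in Set.Ioc (0 : ℝ) (t / (n : ℝ)), g s) ^ n ≤ h n t := by
  intro n hn
  induction n, hn using Nat.le_induction with
  | base =>
    intro t ht
    simp [h1 t ht]
  | succ n hn ih =>
    intro t ht
    have hn0 : (0 : ℝ) < n := by exact_mod_cast hn
    have hle : t / ((n + 1 : ℕ) : ℝ) ≤ t :=
      div_le_self ht (by exact_mod_cast Nat.le_add_left 1 n)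
    have htn : t / ((n + 1 : ℕ) : ℝ) * (n + 1) = t := by
      push_cast
      field_simp
    set a : ℝ := t / ((n + 1 : ℕ) : ℝ)
    calc (∫⁻ s in Set.Ioc (0 : ℝ) a, g s) ^ (n + 1)
        = ∫⁻ s in Set.Ioc (0 : ℝ) a, g s * (∫⁻ r in Set.Ioc (0 : ℝ) a, g r) ^ n := by
          rw [lintegral_mul_const _ hg, pow_succ']
      _ ≤ ∫⁻ s in Set.Ioc (0 : ℝ) a, g s * h n (t - s) := by
          refine setLIntegral_mono' measurableSet_Ioc fun s hs => ?_
          have has : a ≤ (t - s) / n := by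
            rw [le_div_iff₀ hn0]
            linarith [hs.2]
          refine mul_le_mul_right (le_trans ?_ (ih (t - s) (by linarith [hs.2]))) _
          exact pow_le_pow_left' (lintegral_mono_set (Set.Ioc_subset_Ioc_right has)) n
      _ ≤ ∫⁻ s in Set.Ioc (0 : ℝ) t, g s * h n (t - s) :=
          lintegral_mono_set (Set.Ioc_subset_Ioc_right hle)
      _ = h (n + 1) t := (hrec n hn t ht).symm
end

section
/- Let g : [0,∞) → [0,∞) be nonincreasing and measurable, and set Υ(β) := ∫_0^∞ e^{−β s} g(s) ds for β > 0. Then for every t > 0: e^{−1} · Υ(1/t) ≤ ∫_0^t g(s) ds ≤ e · Υ(1/t). -/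
open MeasureTheory ENNReal

/-- The tail of the Laplace transform of a constant beyond the characteristic scale `t`. -/
lemma lintegral_exp_neg_div_Ioi {t : ℝ} (ht : 0 < t) :
    ∫⁻ s in Set.Ioi t, ENNReal.ofReal (Real.exp (-(1 / t) * s)) =
      ENNReal.ofReal (Real.exp (-1)) * ENNReal.ofReal t := by
  have ha : -(1 / t) < 0 := neg_neg_of_pos (by positivity)
  rw [← ofReal_integral_eq_lintegral_ofReal (integrableOn_exp_mul_Ioi ha t)
    (Filter.Eventually.of_forall fun s => (Real.exp_pos _).le), integral_exp_mul_Ioi ha,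
    ← ENNReal.ofReal_mul (Real.exp_pos _).le]
  congr 1
  have h : -(1 / t) * t = -1 := by field_simp
  rw [h]
  field_simp

/-- The tail of the Laplace transform of a nonincreasing function is controlled by its mass
on `(0, t]`. -/
lemma lintegral_exp_neg_div_mul_Ioi_le {g : ℝ → ℝ≥0∞} (hmono : AntitoneOn g (Set.Ici (0 : ℝ)))
    {t : ℝ} (ht : 0 < t) :
    ∫⁻ s in Set.Ioi t, ENNReal.ofReal (Real.exp (-(1 / t) * s)) * g s ≤
      ENNReal.ofReal (Real.exp (-1)) * ∫⁻ s in Set.Ioc (0 : ℝ) t, g s := by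
  calc
    _ ≤ ∫⁻ s in Set.Ioi t, ENNReal.ofReal (Real.exp (-(1 / t) * s)) * g t := by
      refine setLIntegral_mono' measurableSet_Ioi fun s hs => ?_
      gcongr
      exact hmono ht.le (ht.trans hs).le (le_of_lt hs)
    _ = ENNReal.ofReal (Real.exp (-1)) * ∫⁻ _ in Set.Ioc (0 : ℝ) t, g t := by
      rw [lintegral_mul_const _ (by fun_prop), lintegral_exp_neg_div_Ioi ht,
        setLIntegral_const, Real.volume_Ioc, sub_zero, mul_assoc, mul_comm (g t)]
    _ ≤ _ := by
      gcongr ENNReal.ofReal (Real.exp (-1)) * ?_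
      exact setLIntegral_mono' measurableSet_Ioc fun s hs => hmono hs.1.le ht.le hs.2

lemma exp_neg_one_mul_one_add_le_one : Real.exp (-1) * (1 + Real.exp (-1)) ≤ 1 := by
  have h : Real.exp (-1) ≤ 1 / 2 := by
    rw [Real.exp_neg, inv_le_comm₀ (Real.exp_pos 1) (by norm_num)]
    linarith [Real.add_one_le_exp (1 : ℝ)]
  nlinarith [Real.exp_pos (-1)]

/-- The abelian/tauberian comparison (display eq:p:Upsilon, quoted from
Foondun–Khoshnevisan–Nualart): for nonincreasing measurable `g : [0,∞) → [0,∞]` and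
`Υ(β) := ∫_0^∞ e^{−βs} g(s) ds`, one has
`e⁻¹·Υ(1/t) ≤ ∫_0^t g(s) ds ≤ e·Υ(1/t)` for every `t > 0`. -/
theorem abelian_tauberian_bound (g : ℝ → ℝ≥0∞) (hg : Measurable g)
    (hmono : AntitoneOn g (Set.Ici (0 : ℝ))) :
    ∀ t : ℝ, 0 < t →
      ENNReal.ofReal (Real.exp (-1)) *
          (∫⁻ s in Set.Ioi (0 : ℝ), ENNReal.ofReal (Real.exp (-(1 / t) * s)) * g s) ≤
        (∫⁻ s in Set.Ioc (0 : ℝ) t, g s) ∧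
      (∫⁻ s in Set.Ioc (0 : ℝ) t, g s) ≤
        ENNReal.ofReal (Real.exp 1) *
          ∫⁻ s in Set.Ioi (0 : ℝ), ENNReal.ofReal (Real.exp (-(1 / t) * s)) * g s := by
  intro t ht
  constructor
  · have hhead : ∫⁻ s in Set.Ioc (0 : ℝ) t, ENNReal.ofReal (Real.exp (-(1 / t) * s)) * g s ≤
        ∫⁻ s in Set.Ioc (0 : ℝ) t, g s := by
      refine setLIntegral_mono' measurableSet_Ioc fun s hs => mul_le_of_le_one_left' ?_
      rw [ENNReal.ofReal_le_one, Real.exp_le_one_iff, neg_mul]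
      have := hs.1
      exact neg_nonpos.mpr (by positivity)
    rw [← Set.Ioc_union_Ioi_eq_Ioi ht.le,
      lintegral_union measurableSet_Ioi Set.Ioc_disjoint_Ioi_same]
    calc
      _ ≤ ENNReal.ofReal (Real.exp (-1)) * ((∫⁻ s in Set.Ioc (0 : ℝ) t, g s) +
          ENNReal.ofReal (Real.exp (-1)) * ∫⁻ s in Set.Ioc (0 : ℝ) t, g s) := by
        gcongr
        exact lintegral_exp_neg_div_mul_Ioi_le hmono ht
      _ = ENNReal.ofReal (Real.exp (-1) * (1 + Real.exp (-1))) *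
          ∫⁻ s in Set.Ioc (0 : ℝ) t, g s := by
        rw [ENNReal.ofReal_mul (Real.exp_pos _).le,
          ENNReal.ofReal_add zero_le_one (Real.exp_pos _).le, ENNReal.ofReal_one]
        ring
      _ ≤ _ := mul_le_of_le_one_left'
        (ENNReal.ofReal_le_one.mpr exp_neg_one_mul_one_add_le_one)
  · rw [← lintegral_const_mul _ (by fun_prop)]
    refine le_trans (setLIntegral_mono' measurableSet_Ioc fun s hs => ?_)
      (lintegral_mono_set Set.Ioc_subset_Ioi_self)
    rw [← mul_assoc, ← ENNReal.ofReal_mul (Real.exp_pos _).le, ← Real.exp_add]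
    refine le_mul_of_one_le_left' ?_
    rw [ENNReal.one_le_ofReal, Real.one_le_exp_iff]
    have h : 1 / t * s ≤ 1 := by
      rw [one_div_mul_eq_div, div_le_one ht]
      exact hs.2
    linarith
end
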